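/- arXiv:2101.05423 — 2 statements merged into one kernel-verified Lean document; each statement's English description precedes it below -/
import Mathlib

section
/- Let P0 be a probability measure on [0,1] with mean μ0 and variance σ0² > 0, and let κ0(λ) = ln E_{P0}[e^{λX}]. For Δ > 0 small let η = μ0 + 2Δ and let λ*(Δ) > 0 solve κ0'(λ*(Δ)) = η. Then the minimum Kullback–Leibler divergence over the class {P1 on [0,1] : E_{P1}[X] ≥ η}, which equals λ*(Δ)·η − κ0(λ*(Δ)), satisfies λ*(Δ)·η − κ0(λ*(Δ)) = 2Δ²/σ0² + o(Δ²) as Δ → 0. -/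
open MeasureTheory Filter Topology Asymptotics

/-- The cumulant generating function of a measure `P0`:
`κ0(λ) = ln E_{P0}[e^{λX}]`, where `X` is the identity random variable. -/
noncomputable def kappa0 (P0 : Measure ℝ) (l : ℝ) : ℝ :=
  Real.log (∫ x, Real.exp (l * x) ∂P0)

open ProbabilityTheory

lemma aux_calc (K m v : ℝ → ℝ) (a s : ℝ) (hs : 0 < s) (hK0 : K 0 = 0) (hm0 : m 0 = a)
    (hv0 : v 0 = s) (hv : ∀ x, 0 ≤ v x) (hvc : ContinuousAt v 0)
    (hK : ∀ x, HasDerivAt K (m x) x) (hm : ∀ x, HasDerivAt m (v x) x) (lam : ℝ → ℝ)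
    (h_lam : ∀ᶠ Δ in 𝓝[>] (0:ℝ), 0 < lam Δ ∧ m (lam Δ) = a + 2 * Δ) :
    (fun Δ : ℝ => lam Δ * (a + 2 * Δ) - K (lam Δ) - 2 * Δ ^ 2 / s)
      =o[𝓝[>] (0:ℝ)] (fun Δ : ℝ => Δ ^ 2) := by
  have hmono : Monotone m := by
    apply monotone_of_deriv_nonneg (fun x => (hm x).differentiableAt)
    intro x
    rw [(hm x).deriv]
    exact hv x
  have hlin : (fun l : ℝ => m l - a - l * s) =o[𝓝 0] (fun l : ℝ => l) := by
    have h := (hm 0).isLittleO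
    simpa [hm0, hv0] using h
  have hlow : ∀ᶠ l in 𝓝 (0:ℝ), 0 < l → s / 2 * l ≤ m l - a := by
    filter_upwards [hlin.def (half_pos hs)] with l hl hpos
    rw [Real.norm_eq_abs, Real.norm_eq_abs, abs_of_pos hpos] at hl
    have := (abs_le.1 hl).1
    linarith
  obtain ⟨δ, hδ, hlow⟩ := Metric.eventually_nhds_iff.1 hlow
  have hlam0 : Tendsto lam (𝓝[>] 0) (𝓝 0) := by
    rw [Metric.tendsto_nhds]
    intro ε hε
    set e := min (ε / 2) (δ / 2) with he
    have he0 : 0 < e := by positivity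
    have heε : e < ε := lt_of_le_of_lt (min_le_left _ _) (by linarith)
    have heδ : e < δ := lt_of_le_of_lt (min_le_right _ _) (by linarith)
    have h1 : s / 2 * e ≤ m e - a := hlow (by simpa [abs_of_pos he0] using heδ) he0
    have h2 : 0 < s / 2 * e := by positivity
    have h3 : ∀ᶠ Δ in 𝓝[>] (0:ℝ), Δ < (s / 2 * e) / 2 :=
      nhdsWithin_le_nhds (eventually_lt_nhds (by positivity))
    filter_upwards [h_lam, h3] with Δ hΔ hΔ3
    have : lam Δ < e := by
      by_contra! hc
      have := hmono hc
      linarith [hΔ.2]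
    rw [Real.dist_eq, sub_zero, abs_of_pos hΔ.1]
    linarith
  have hO : lam =O[𝓝[>] 0] (fun Δ : ℝ => Δ) := by
    apply IsBigO.of_bound (4 / s)
    filter_upwards [h_lam, Metric.tendsto_nhds.1 hlam0 δ hδ, self_mem_nhdsWithin] with Δ hΔ h1 hp
    have h2 := hlow h1 hΔ.1
    rw [Real.norm_eq_abs, Real.norm_eq_abs, abs_of_pos hΔ.1, abs_of_pos hp, div_mul_eq_mul_div,
      le_div_iff₀ hs]
    linarith [hΔ.2]
  -- the auxiliary function
  set h : ℝ → ℝ := fun l => l * m l - K l - (m l - a) ^ 2 / (2 * s) with hh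
  set h' : ℝ → ℝ := fun l => -(v l * ((m l - a - l * s) / s)) with hh'
  have hder : ∀ l, HasDerivAt h (h' l) l := by
    intro l
    have := (((hasDerivAt_id l).mul (hm l)).sub (hK l)).sub
      ((((hm l).sub_const a).pow 2).div_const (2 * s))
    refine (this.congr_deriv ?_ : HasDerivAt h (h' l) l)
    simp only [h', id, Nat.cast_ofNat, one_mul, Nat.add_one_sub_one, pow_one]
    field_simp
    ring
  have hh'o : h' =o[𝓝 0] (fun l : ℝ => l) := by
    have h1 : v =O[𝓝 0] (fun _ => (1:ℝ)) := hvc.isBigO_one ℝ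
    have h2 := h1.mul_isLittleO (hlin.mul_isBigO (isBigO_refl (fun _ : ℝ => (1:ℝ) / s) _))
    have h3 : (fun l : ℝ => 1 * (l * (1 / s))) =O[𝓝 0] (fun l : ℝ => l) := by
      apply IsBigO.of_bound ‖1 / s‖
      filter_upwards with l
      simp [mul_comm]
    have h4 := (h2.trans_isBigO h3).neg_left
    refine h4.congr_left ?_
    intro l
    simp [hh', div_eq_mul_inv]
  have hho : h =o[𝓝 0] (fun l : ℝ => l ^ 2) := by
    rw [isLittleO_iff]
    intro c hc
    obtain ⟨r, hr, hb⟩ := Metric.eventually_nhds_iff.1 (hh'o.def hc)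
    rw [Metric.eventually_nhds_iff]
    refine ⟨r, hr, fun {l} hl => ?_⟩
    have key := (convex_uIcc (0:ℝ) l).norm_image_sub_le_of_norm_hasDerivWithin_le
      (f := h) (f' := h') (C := c * ‖l‖) (x := 0) (y := l)
      (fun x _ => (hder x).hasDerivWithinAt) ?_ Set.left_mem_uIcc Set.right_mem_uIcc
    · have h0 : h 0 = 0 := by simp [hh, hK0, hm0]
      rw [h0, sub_zero, sub_zero] at key
      rw [norm_pow]
      linarith
    · intro x hx
      have hxl : ‖x‖ ≤ ‖l‖ := by
        have := Set.abs_sub_left_of_mem_uIcc hx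
        simpa using this
      have : dist x 0 < r := by
        rw [dist_zero_right] at hl ⊢
        linarith
      exact (hb this).trans (by gcongr)
  have hfin := (hho.comp_tendsto hlam0).trans_isBigO (hO.pow 2)
  refine hfin.congr' ?_ EventuallyEq.rfl
  filter_upwards [h_lam] with Δ hΔ
  simp only [Function.comp, hh, hΔ.2]
  field_simp
  ring

/-- Asymptotics of the minimum KL divergence: with `η = μ0 + 2Δ` and `λ*(Δ) > 0` solving
`κ0'(λ*(Δ)) = η`, the minimum Kullback–Leibler divergence `λ*(Δ)·η − κ0(λ*(Δ))` over
`{P1 on [0,1] : E_{P1}[X] ≥ η}` satisfies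
`λ*(Δ)·η − κ0(λ*(Δ)) = 2Δ²/σ0² + o(Δ²)` as `Δ → 0⁺`. -/
theorem min_klDiv_asymptotics (P0 : Measure ℝ) [IsProbabilityMeasure P0]
    (h_supp : P0 ((Set.Icc (0:ℝ) 1)ᶜ) = 0) (μ0 σ0sq : ℝ)
    (h_mean : μ0 = ∫ x, x ∂P0)
    (h_var : σ0sq = (∫ x, x ^ 2 ∂P0) - μ0 ^ 2) (h_var_pos : 0 < σ0sq)
    (lam : ℝ → ℝ)
    (h_lam : ∀ᶠ Δ in 𝓝[>] (0:ℝ), 0 < lam Δ ∧ deriv (kappa0 P0) (lam Δ) = μ0 + 2 * Δ) :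
    (fun Δ : ℝ => lam Δ * (μ0 + 2 * Δ) - kappa0 P0 (lam Δ) - 2 * Δ ^ 2 / σ0sq)
      =o[𝓝[>] (0:ℝ)] (fun Δ : ℝ => Δ ^ 2) := by
  have hb : ∀ᵐ x ∂P0, (id x : ℝ) ∈ Set.Icc (0:ℝ) 1 := by
    rw [ae_iff]
    exact h_supp
  have hi : ∀ t, t ∈ interior (integrableExpSet id P0) := by
    intro t
    have : integrableExpSet id P0 = Set.univ := by
      ext u
      simpa [integrableExpSet] using
        integrable_exp_mul_of_mem_Icc (t := u) (measurable_id.aemeasurable) hb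
    simp [this]
  have hk : kappa0 P0 = cgf id P0 := by
    ext l
    simp [kappa0, cgf, mgf]
  have han : ∀ x, AnalyticAt ℝ (cgf id P0) x := fun x => analyticAt_cgf (hi x)
  have h2 : iteratedDeriv 2 (cgf id P0) = deriv (deriv (cgf id P0)) := by
    rw [iteratedDeriv_succ, iteratedDeriv_one]
  rw [hk] at h_lam ⊢
  have hm0 : deriv (cgf id P0) 0 = μ0 := by
    rw [deriv_cgf_zero (hi 0)]
    simp [h_mean]
  refine aux_calc (cgf id P0) (deriv (cgf id P0)) (deriv (deriv (cgf id P0))) μ0 σ0sq h_var_pos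
    (by simp) hm0 ?_ ?_ (han 0).deriv.deriv.continuousAt
    (fun x => (han x).differentiableAt.hasDerivAt)
    (fun x => (han x).deriv.differentiableAt.hasDerivAt) lam h_lam
  · rw [← h2, iteratedDeriv_two_cgf (hi 0), hm0, h_var]
    simp
  · intro x
    rw [← h2, ← variance_tilted_mul (hi x)]
    exact variance_nonneg _ _
end

section
/- Let P0 be a probability measure on [0,1] with mean μ0 and variance σ0² > 0, and let κ0(λ) = ln E_{P0}[e^{λX}]. For Δ > 0 small let η = μ0 + 2Δ and let λ*(Δ) > 0 solve κ0'(λ*(Δ)) = η. Then the optimal log-likelihood-ratio increment is uniformly approximated by the mean-change statistic increment: sup_{x ∈ [0,1]} | λ*(Δ)·x − κ0(λ*(Δ)) − (2Δ/σ0²)(x − (μ0 + η)/2) | = o(Δ) as Δ → 0. -/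
open MeasureTheory Filter Topology Asymptotics

/-- Uniform approximation of the optimal log-likelihood-ratio increment by the mean-change
statistic increment: with `η = μ0 + 2Δ` and `λ*(Δ) > 0` solving `κ0'(λ*(Δ)) = η`,
`sup_{x ∈ [0,1]} | λ*(Δ)·x − κ0(λ*(Δ)) − (2Δ/σ0²)(x − (μ0 + η)/2) | = o(Δ)` as `Δ → 0⁺`. -/
theorem llr_increment_uniform_approx (P0 : Measure ℝ) [IsProbabilityMeasure P0]
    (h_supp : P0 ((Set.Icc (0:ℝ) 1)ᶜ) = 0) (μ0 σ0sq : ℝ)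
    (h_mean : μ0 = ∫ x, x ∂P0)
    (h_var : σ0sq = (∫ x, x ^ 2 ∂P0) - μ0 ^ 2) (h_var_pos : 0 < σ0sq)
    (lam : ℝ → ℝ)
    (h_lam : ∀ᶠ Δ in 𝓝[>] (0:ℝ), 0 < lam Δ ∧ deriv (kappa0 P0) (lam Δ) = μ0 + 2 * Δ) :
    (fun Δ : ℝ =>
        ⨆ x : Set.Icc (0:ℝ) 1,
          |lam Δ * (x : ℝ) - kappa0 P0 (lam Δ)
            - (2 * Δ / σ0sq) * ((x : ℝ) - (μ0 + (μ0 + 2 * Δ)) / 2)|)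
      =o[𝓝[>] (0:ℝ)] (fun Δ : ℝ => Δ) := by
  have hbd : ∀ᵐ x ∂P0, x ∈ Set.Icc (0:ℝ) 1 := by
    rw [ae_iff]; exact h_supp
  have hint : ∀ t : ℝ, Integrable (fun x : ℝ => Real.exp (t * x)) P0 := by
    intro t
    refine Integrable.of_bound (by fun_prop) (Real.exp |t|) ?_
    filter_upwards [hbd] with x hx
    rw [Real.norm_eq_abs, abs_of_pos (Real.exp_pos _)]
    apply Real.exp_le_exp.mpr
    calc t * x ≤ |t * x| := le_abs_self _
      _ = |t| * x := by rw [abs_mul, abs_of_nonneg hx.1]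
      _ ≤ |t| := mul_le_of_le_one_right (abs_nonneg _) hx.2
  have hset : ∀ t : ℝ, t ∈ interior (ProbabilityTheory.integrableExpSet id P0) := by
    intro t
    have : ProbabilityTheory.integrableExpSet id P0 = Set.univ := by
      ext t; simpa [ProbabilityTheory.integrableExpSet] using hint t
    rw [this, interior_univ]; trivial
  have hk : kappa0 P0 = ProbabilityTheory.cgf id P0 := by
    ext l; simp [kappa0, ProbabilityTheory.cgf, ProbabilityTheory.mgf]
  have han : ∀ t, AnalyticAt ℝ (kappa0 P0) t := by
    intro t; rw [hk]; exact ProbabilityTheory.analyticAt_cgf (hset t)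
  have hk0 : kappa0 P0 0 = 0 := by simp [kappa0]
  have hd0 : deriv (kappa0 P0) 0 = μ0 := by
    rw [hk, ProbabilityTheory.deriv_cgf_zero (hset 0), h_mean]; simp
  have hdd : ∀ t, deriv (deriv (kappa0 P0)) t = iteratedDeriv 2 (kappa0 P0) t := by
    intro t; rw [iteratedDeriv_succ, iteratedDeriv_one]
  have hd20 : deriv (deriv (kappa0 P0)) 0 = σ0sq := by
    rw [hdd, hk, ProbabilityTheory.iteratedDeriv_two_cgf (hset 0), ← hk, hd0, h_var]
    simp
  have hmono : Monotone (deriv (kappa0 P0)) := by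
    apply monotone_of_deriv_nonneg
    · intro t; exact (han t).deriv.differentiableAt
    · intro t
      rw [hdd, hk, ProbabilityTheory.iteratedDeriv_two_cgf_eq_integral (hset t)]
      apply div_nonneg
      · apply integral_nonneg
        intro x; simp only [Pi.zero_apply]; positivity
      · exact ProbabilityTheory.mgf_nonneg
  have hD2 : HasDerivAt (deriv (kappa0 P0)) σ0sq 0 := by
    rw [← hd20]; exact (han 0).deriv.differentiableAt.hasDerivAt
  have hD1 : HasDerivAt (kappa0 P0) μ0 0 := by
    rw [← hd0]; exact (han 0).differentiableAt.hasDerivAt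
  -- lam tends to 0
  have hlim : Tendsto lam (𝓝[>] (0:ℝ)) (𝓝 0) := by
    rw [Metric.tendsto_nhds]
    intro ε hε
    obtain ⟨t, ht0, htε, htf⟩ : ∃ t : ℝ, 0 < t ∧ t < ε ∧ μ0 < deriv (kappa0 P0) t := by
      have h1 := (hasDerivAt_iff_tendsto_slope.mp hD2).eventually (lt_mem_nhds h_var_pos)
      have h2 : ∀ᶠ t in 𝓝[>] (0:ℝ), 0 < slope (deriv (kappa0 P0)) 0 t :=
        h1.filter_mono (nhdsWithin_mono _ (fun x hx => ne_of_gt hx))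
      have h3 : ∀ᶠ t in 𝓝[>] (0:ℝ), t < ε :=
        (gt_mem_nhds hε).filter_mono nhdsWithin_le_nhds
      obtain ⟨t, ⟨ha, hb⟩, hc⟩ := ((h2.and h3).and self_mem_nhdsWithin).exists
      have hc : 0 < t := hc
      refine ⟨t, hc, hb, ?_⟩
      rw [slope_def_field, hd0, sub_zero] at ha
      have := (div_pos_iff_of_pos_right hc).mp ha
      linarith
    have h4 : ∀ᶠ Δ in 𝓝[>] (0:ℝ), Δ < (deriv (kappa0 P0) t - μ0) / 2 :=
      (gt_mem_nhds (by linarith)).filter_mono nhdsWithin_le_nhds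
    filter_upwards [h_lam, h4] with Δ h h4
    rw [Real.dist_eq, sub_zero, abs_of_pos h.1]
    by_contra hcon
    have := hmono (show t ≤ lam Δ by linarith)
    rw [h.2] at this
    linarith
  have hA0 : (fun Δ => 2 * Δ - σ0sq * lam Δ) =o[𝓝[>] (0:ℝ)] lam := by
    have h := (hasDerivAt_iff_isLittleO.mp hD2).comp_tendsto hlim
    refine h.congr' ?_ ?_
    · filter_upwards [h_lam] with Δ hΔ
      simp only [Function.comp, hΔ.2, hd0, smul_eq_mul]; ring
    · filter_upwards with Δ; simp
  have hB0 : (fun Δ => kappa0 P0 (lam Δ) - μ0 * lam Δ) =o[𝓝[>] (0:ℝ)] lam := by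
    have h := (hasDerivAt_iff_isLittleO.mp hD1).comp_tendsto hlim
    refine h.congr' ?_ ?_
    · filter_upwards with Δ
      simp only [Function.comp, hk0, smul_eq_mul]; ring
    · filter_upwards with Δ; simp
  have hne : σ0sq ≠ 0 := h_var_pos.ne'
  have hequiv : IsEquivalent (𝓝[>] (0:ℝ)) (fun Δ => 2 * Δ) (fun Δ => σ0sq * lam Δ) :=
    (isLittleO_const_mul_right_iff hne).mpr hA0
  have hlO : lam =O[𝓝[>] (0:ℝ)] (fun Δ : ℝ => Δ) := by
    have h := hequiv.symm.isBigO
    have h2 := (isBigO_const_mul_left_iff hne).mp h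
    exact (isBigO_const_mul_right_iff (two_ne_zero)).mp h2
  have hA : (fun Δ => 2 * Δ - σ0sq * lam Δ) =o[𝓝[>] (0:ℝ)] (fun Δ : ℝ => Δ) := hA0.trans_isBigO hlO
  have hB : (fun Δ => kappa0 P0 (lam Δ) - μ0 * lam Δ) =o[𝓝[>] (0:ℝ)] (fun Δ : ℝ => Δ) :=
    hB0.trans_isBigO hlO
  have hC : (fun Δ : ℝ => Δ ^ 2) =o[𝓝[>] (0:ℝ)] (fun Δ : ℝ => Δ) := by
    have h : (fun Δ : ℝ => Δ ^ 2) =o[𝓝 (0:ℝ)] (fun Δ : ℝ => Δ ^ 1) :=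
      isLittleO_pow_pow (by norm_num)
    simpa using h.mono nhdsWithin_le_nhds
  have hsum := ((hA.abs_left.const_mul_left ((1 + |μ0|) / σ0sq)).add hB.abs_left).add
    (hC.const_mul_left (2 / σ0sq))
  refine IsBigO.trans_isLittleO (IsBigO.of_bound 1 ?_) hsum
  filter_upwards with Δ
  rw [one_mul, Real.norm_eq_abs, Real.norm_eq_abs,
    abs_of_nonneg (Real.iSup_nonneg fun _ => abs_nonneg _)]
  refine le_trans ?_ (le_abs_self _)
  have : Nonempty (Set.Icc (0:ℝ) 1) := ⟨⟨0, by simp⟩⟩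
  apply ciSup_le
  rintro ⟨x, hx0, hx1⟩
  simp only
  have e : lam Δ * x - kappa0 P0 (lam Δ) - (2 * Δ / σ0sq) * (x - (μ0 + (μ0 + 2 * Δ)) / 2)
      = (2 * Δ - σ0sq * lam Δ) * ((μ0 - x) / σ0sq) - (kappa0 P0 (lam Δ) - μ0 * lam Δ)
        + 2 / σ0sq * Δ ^ 2 := by
    field_simp; ring
  rw [e]
  have hx : |μ0 - x| ≤ 1 + |μ0| := by
    have := abs_sub μ0 x
    rw [abs_of_nonneg hx0] at this
    linarith
  have h1 : |(2 * Δ - σ0sq * lam Δ) * ((μ0 - x) / σ0sq)|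
      ≤ (1 + |μ0|) / σ0sq * |2 * Δ - σ0sq * lam Δ| := by
    rw [abs_mul, abs_div, abs_of_pos h_var_pos, mul_comm]
    gcongr
  have h2 : |2 / σ0sq * Δ ^ 2| = 2 / σ0sq * Δ ^ 2 := abs_of_nonneg (by positivity)
  refine (abs_add_le _ _).trans ?_
  rw [h2]
  gcongr
  refine (abs_sub _ _).trans ?_
  gcongr
end
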